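/- arXiv:2002.04445 — 6 statements merged into one kernel-verified Lean document; each statement's English description precedes it below -/
import Mathlib

section
/- Let p be a prime with p = e·f + 1 for positive integers e, f, let g be a primitive root modulo p, let ζ = exp(2πi/p), and define the Gauss periods η_i = Σ_{k=0}^{f−1} ζ^{g^{ke+i}} for i = 0,…,e−1 and the period polynomial ψ_e(X) = ∏_{i=0}^{e−1} (X − η_i). Then the periods η_0, …, η_{e−1} are pairwise distinct and ψ_e is irreducible over ℚ; in particular ψ_e is the minimal polynomial over ℚ of each period η_i. -/
open Polynomial

/-- A rational polynomial of degree less than `p` without constant term that vanishes at a primitive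
`p`-th root of unity is zero. -/
theorem eq_zero_of_aeval_primitiveRoot_eq_zero {p : ℕ} (hp : p.Prime) {ζ : ℂ}
    (hζ : IsPrimitiveRoot ζ p) {P : ℚ[X]} (hdeg : P.degree < p) (h0 : P.coeff 0 = 0)
    (hP : aeval ζ P = 0) : P = 0 := by
  obtain ⟨Q, rfl⟩ := X_dvd_iff.2 h0
  have hQ : aeval ζ Q = 0 := by
    simpa [hζ.ne_zero hp.ne_zero] using hP
  suffices Q = 0 by simp [this]
  by_contra hne
  have hle := minpoly.degree_le_of_ne_zero ℚ ζ hne hQ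
  rw [← cyclotomic_eq_minpoly_rat hζ hp.pos, degree_cyclotomic, Nat.totient_prime hp,
    degree_eq_natDegree hne, Nat.cast_le] at hle
  rw [mul_comm, degree_mul, degree_X, degree_eq_natDegree hne] at hdeg
  have hlt : Q.natDegree + 1 < p := by exact_mod_cast hdeg
  omega

/-- Evaluating a rational polynomial at two primitive `p`-th roots of unity yields the same
vanishing condition. -/
theorem aeval_eq_zero_of_primitiveRoot {p : ℕ} (hp : 0 < p) {ζ ξ : ℂ}
    (hζ : IsPrimitiveRoot ζ p) (hξ : IsPrimitiveRoot ξ p) {P : ℚ[X]}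
    (hP : aeval ζ P = 0) : aeval ξ P = 0 := by
  have hdvd := minpoly.dvd ℚ ζ hP
  rw [← cyclotomic_eq_minpoly_rat hζ hp, cyclotomic_eq_minpoly_rat hξ hp] at hdvd
  exact aeval_eq_zero_of_dvd_aeval_eq_zero hdvd (minpoly.aeval ℚ ξ)

/-- The Gauss period `∑_{k < f} x ^ (g ^ (k * e + i))`. -/
def gaussPeriod {R : Type*} [Semiring R] (e f g i : ℕ) (x : R) : R :=
  ∑ k ∈ Finset.range f, x ^ (g ^ (k * e + i))

theorem map_gaussPeriod {R S F : Type*} [Semiring R] [Semiring S] [FunLike F R S]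
    [RingHomClass F R S] (φ : F) (e f g i : ℕ) (x : R) :
    φ (gaussPeriod e f g i x) = gaussPeriod e f g i (φ x) := by
  simp [gaussPeriod]

theorem gaussPeriod_pow {R : Type*} [Semiring R] (e f g i j : ℕ) (x : R) :
    gaussPeriod e f g i (x ^ g ^ j) = gaussPeriod e f g (i + j) x := by
  simp only [gaussPeriod, ← pow_mul, ← pow_add]
  refine Finset.sum_congr rfl fun k _ => ?_
  congr 2
  ring

theorem pow_eq_pow_of_natCast_eq {M : Type*} [Monoid M] {p : ℕ} {x : M} (hx : x ^ p = 1)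
    {a b : ℕ} (h : (a : ZMod p) = b) : x ^ a = x ^ b := by
  have hmod : a % p = b % p := (ZMod.natCast_eq_natCast_iff _ _ _).1 h
  rw [pow_eq_pow_mod a hx, hmod, ← pow_eq_pow_mod b hx]

theorem gaussPeriod_periodic {R : Type*} [CommRing R] {p e f g : ℕ} (hpef : p = e * f + 1)
    (hg : orderOf (g : ZMod p) = p - 1) {x : R} (hx : x ^ p = 1) :
    Function.Periodic (fun i => gaussPeriod e f g i x) e := by
  intro i
  have hshift : ∀ k, k * e + (i + e) = (k + 1) * e + i := fun k => by ring
  have hlast : x ^ g ^ (f * e + i) = x ^ g ^ (0 * e + i) := by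
    refine pow_eq_pow_of_natCast_eq hx ?_
    have hone : (g : ZMod p) ^ (f * e) = 1 := by
      rw [← orderOf_dvd_iff_pow_eq_one, hg, hpef, mul_comm f e, Nat.add_sub_cancel]
    push_cast
    rw [pow_add, hone, zero_mul, pow_add, pow_zero]
  simp only [gaussPeriod, hshift]
  have h := Finset.sum_range_succ' (fun k => x ^ g ^ (k * e + i)) f
  rw [Finset.sum_range_succ, hlast] at h
  exact (add_right_cancel h).symm

theorem exists_pow_eq_natCast {p g : ℕ} (hp : p.Prime) (hg : orderOf (g : ZMod p) = p - 1)
    {a : ZMod p} (ha : a ≠ 0) : ∃ j : ℕ, (g : ZMod p) ^ j = a := by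
  have := Fact.mk hp
  have : NeZero (p - 1) := ⟨Nat.sub_ne_zero_of_lt hp.one_lt⟩
  have hprim : IsPrimitiveRoot (g : ZMod p) (p - 1) := hg ▸ IsPrimitiveRoot.orderOf _
  obtain ⟨j, -, hj⟩ := hprim.eq_pow_of_pow_eq_one (ZMod.pow_card_sub_one_eq_one ha)
  exact ⟨j, hj⟩

theorem natCast_ne_zero_of_orderOf {p g : ℕ} (hp : p.Prime)
    (hg : orderOf (g : ZMod p) = p - 1) : (g : ZMod p) ≠ 0 := by
  have := Fact.mk hp
  intro h
  have hone := pow_orderOf_eq_one (g : ZMod p)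
  rw [hg, h, zero_pow (Nat.sub_ne_zero_of_lt hp.one_lt)] at hone
  exact zero_ne_one hone

theorem IsPrimitiveRoot.pow_primitive_pow {p g : ℕ} (hp : p.Prime)
    (hg : orderOf (g : ZMod p) = p - 1) {ζ : ℂ} (hζ : IsPrimitiveRoot ζ p) (i : ℕ) :
    IsPrimitiveRoot (ζ ^ g ^ i) p := by
  refine hζ.pow_of_coprime _ (Nat.Coprime.pow_left _ ?_)
  rw [Nat.coprime_comm, hp.coprime_iff_not_dvd, ← ZMod.natCast_eq_zero_iff]
  exact natCast_ne_zero_of_orderOf hp hg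

theorem gaussPeriod_injOn {p e f g : ℕ} (hp : p.Prime) (hf : 0 < f) (hpef : p = e * f + 1)
    (hg : orderOf (g : ZMod p) = p - 1) {ζ : ℂ} (hζ : IsPrimitiveRoot ζ p) :
    Set.InjOn (fun i => gaussPeriod e f g i ζ) (Finset.range e) := by
  have := Fact.mk hp
  have hg0 := natCast_ne_zero_of_orderOf hp hg
  let P : ℕ → ℚ[X] := fun i => ∑ k ∈ Finset.range f, X ^ ((g : ZMod p) ^ (k * e + i)).val
  have hPζ : ∀ i, aeval ζ (P i) = gaussPeriod e f g i ζ := by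
    intro i
    simp only [P, gaussPeriod, map_sum, map_pow, aeval_X]
    refine Finset.sum_congr rfl fun k _ => pow_eq_pow_of_natCast_eq hζ.pow_eq_one ?_
    simp
  have hdeg : ∀ i, (P i).degree < p := fun i =>
    (degree_sum_le _ _).trans_lt <| (Finset.sup_lt_iff (WithBot.bot_lt_coe p)).2 fun k _ => by
      rw [degree_X_pow]
      exact Nat.cast_lt.2 (ZMod.val_lt _)
  have hcoeff : ∀ i n, (P i).coeff n =
      ∑ k ∈ Finset.range f, if n = ((g : ZMod p) ^ (k * e + i)).val then 1 else 0 := by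
    intro i n
    simp [P, coeff_X_pow]
  have hcoeff_zero : ∀ i, (P i).coeff 0 = 0 := by
    intro i
    rw [hcoeff]
    refine Finset.sum_eq_zero fun k _ => if_neg fun h => ?_
    exact pow_ne_zero (k * e + i) hg0 ((ZMod.val_eq_zero _).1 h.symm)
  intro i hi j hj hij
  have hi : i < e := by simpa using hi
  have hj : j < e := by simpa using hj
  have hPij : P i = P j := by
    refine sub_eq_zero.1 (eq_zero_of_aeval_primitiveRoot_eq_zero hp hζ ?_ ?_ ?_)
    · exact (degree_sub_le _ _).trans_lt (max_lt (hdeg i) (hdeg j))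
    · rw [coeff_sub, hcoeff_zero, hcoeff_zero, sub_zero]
    · rw [map_sub, hPζ, hPζ, sub_eq_zero]
      exact hij
  have hpos : (P i).coeff ((g : ZMod p) ^ i).val ≠ 0 := by
    rw [hcoeff]
    refine (Finset.sum_pos' (fun k _ => by split_ifs <;> norm_num)
      ⟨0, Finset.mem_range.2 hf, ?_⟩).ne'
    simp
  rw [hPij, hcoeff] at hpos
  obtain ⟨k, -, hk⟩ := Finset.exists_ne_zero_of_sum_ne_zero hpos
  have hval : ((g : ZMod p) ^ i).val = ((g : ZMod p) ^ (k * e + j)).val := by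
    by_contra h
    exact hk (if_neg h)
  have hpow := ZMod.val_injective p hval
  have hfin : IsOfFinOrder (g : ZMod p) := by
    rw [← orderOf_pos_iff, hg]
    exact Nat.sub_pos_of_lt hp.one_lt
  have hmod : i ≡ k * e + j [MOD e] := by
    refine (hfin.pow_eq_pow_iff_modEq.1 hpow).of_dvd ?_
    rw [hg, hpef, Nat.add_sub_cancel]
    exact dvd_mul_right e f
  have hmod' : i % e = j % e := by
    simpa [Nat.ModEq, Nat.add_mod] using hmod
  rwa [Nat.mod_eq_of_lt hi, Nat.mod_eq_of_lt hj] at hmod'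

theorem rootSet_minpoly_gaussPeriod {p e f g : ℕ} (hp : p.Prime) (he : 0 < e)
    (hpef : p = e * f + 1) (hg : orderOf (g : ZMod p) = p - 1) {ζ : ℂ}
    (hζ : IsPrimitiveRoot ζ p) :
    (minpoly ℚ (gaussPeriod e f g 0 ζ)).rootSet ℂ =
      (fun i => gaussPeriod e f g i ζ) '' Finset.range e := by
  have hint : IsIntegral ℚ ζ := (hζ.isIntegral hp.pos).tower_top
  have hηint : IsIntegral ℚ (gaussPeriod e f g 0 ζ) :=
    IsIntegral.sum _ fun _ _ => hint.pow _
  ext β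
  constructor
  · intro hβ
    have : FiniteDimensional ℚ (IntermediateField.adjoin ℚ {ζ}) :=
      IntermediateField.adjoin.finiteDimensional hint
    let γ : IntermediateField.adjoin ℚ {ζ} := IntermediateField.AdjoinSimple.gen ℚ ζ
    have hγ : algebraMap _ ℂ γ = ζ := IntermediateField.AdjoinSimple.algebraMap_gen ℚ ζ
    have hinj : Function.Injective (algebraMap (IntermediateField.adjoin ℚ {ζ}) ℂ) :=
      RingHom.injective _
    have hmin : minpoly ℚ (gaussPeriod e f g 0 ζ) = minpoly ℚ (gaussPeriod e f g 0 γ) := by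
      rw [← minpoly.algebraMap_eq hinj, map_gaussPeriod, hγ]
    rw [hmin, ← Algebra.IsAlgebraic.range_eval_eq_rootSet_minpoly] at hβ
    obtain ⟨φ, rfl⟩ := hβ
    have hγprim : IsPrimitiveRoot γ p :=
      IsPrimitiveRoot.of_map_of_injective (f := algebraMap _ ℂ) (hγ.symm ▸ hζ) hinj
    have hφprim : IsPrimitiveRoot (φ γ) p := hγprim.map_of_injective φ.injective
    have : NeZero p := ⟨hp.ne_zero⟩
    obtain ⟨m, -, hm⟩ := hζ.eq_pow_of_pow_eq_one hφprim.pow_eq_one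
    have hm0 : (m : ZMod p) ≠ 0 := by
      intro h
      refine hφprim.ne_one hp.one_lt ?_
      rw [← hm, hζ.pow_eq_one_iff_dvd, ← ZMod.natCast_eq_zero_iff]
      exact h
    obtain ⟨j, hj⟩ := exists_pow_eq_natCast hp hg hm0
    refine ⟨j % e, by simpa using Nat.mod_lt j he, ?_⟩
    have hper := (gaussPeriod_periodic hpef hg hζ.pow_eq_one).map_mod_nat j
    refine hper.trans ?_
    have hmj : ζ ^ m = ζ ^ g ^ j :=
      pow_eq_pow_of_natCast_eq hζ.pow_eq_one (by rw [← hj, Nat.cast_pow])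
    change _ = φ (gaussPeriod e f g 0 γ)
    rw [map_gaussPeriod, ← hm, hmj, gaussPeriod_pow, zero_add]
  · rintro ⟨i, -, rfl⟩
    rw [mem_rootSet]
    refine ⟨minpoly.ne_zero hηint, ?_⟩
    have hcomp : ∀ x : ℂ, aeval x ((minpoly ℚ (gaussPeriod e f g 0 ζ)).comp
        (gaussPeriod e f g 0 X)) =
        aeval (gaussPeriod e f g 0 x) (minpoly ℚ (gaussPeriod e f g 0 ζ)) := by
      intro x
      rw [aeval_comp, map_gaussPeriod, aeval_X]
    have h := aeval_eq_zero_of_primitiveRoot hp.pos hζ (hζ.pow_primitive_pow hp hg i)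
      ((hcomp ζ).trans (minpoly.aeval ℚ _))
    rwa [hcomp, gaussPeriod_pow, zero_add] at h

theorem map_minpoly_gaussPeriod {p e f g : ℕ} (hp : p.Prime) (he : 0 < e) (hf : 0 < f)
    (hpef : p = e * f + 1) (hg : orderOf (g : ZMod p) = p - 1) {ζ : ℂ}
    (hζ : IsPrimitiveRoot ζ p) :
    (minpoly ℚ (gaussPeriod e f g 0 ζ)).map (algebraMap ℚ ℂ) =
      ∏ i ∈ Finset.range e, (X - C (gaussPeriod e f g i ζ)) := by
  classical
  have hint : IsIntegral ℚ (gaussPeriod e f g 0 ζ) :=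
    IsIntegral.sum _ fun _ _ => (hζ.isIntegral hp.pos).tower_top.pow _
  set q := minpoly ℚ (gaussPeriod e f g 0 ζ) with hq
  have hsep : (q.map (algebraMap ℚ ℂ)).Separable := (minpoly.irreducible hint).separable.map
  have hmonic : (q.map (algebraMap ℚ ℂ)).Monic := (minpoly.monic hint).map _
  have hroots : (q.map (algebraMap ℚ ℂ)).roots.toFinset =
      (Finset.range e).image fun i => gaussPeriod e f g i ζ := by
    apply Finset.coe_injective
    rw [Finset.coe_image, ← rootSet_minpoly_gaussPeriod hp he hpef hg hζ, rootSet, aroots]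
  rw [(IsAlgClosed.splits (q.map (algebraMap ℚ ℂ))).eq_prod_roots_of_monic hmonic,
    ← Finset.prod_image (f := fun a => X - C a) (gaussPeriod_injOn hp hf hpef hg hζ), ← hroots,
    Finset.prod_multiset_map_count]
  refine Finset.prod_congr rfl fun a ha => ?_
  rw [Multiset.count_eq_one_of_mem (nodup_roots hsep) (Multiset.mem_toFinset.1 ha), pow_one]

/-- The Gauss periods `η_0, …, η_{e−1}` are pairwise distinct, and the period polynomial
`ψ_e(X) = ∏_{i<e} (X - η_i)` is (the image of) a polynomial over `ℚ` that is irreducible,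
being the minimal polynomial over `ℚ` of each period `η_i`. -/
theorem period_polynomial_irreducible (p e f : ℕ) (hp : p.Prime)
    (he : 0 < e) (hf : 0 < f) (hpef : p = e * f + 1)
    (g : ℕ) (hg : orderOf (g : ZMod p) = p - 1)
    (ζ : ℂ) (hζ : ζ = Complex.exp (2 * (Real.pi : ℂ) * Complex.I / p))
    (η : ℕ → ℂ) (hη : ∀ i, η i = ∑ k ∈ Finset.range f, ζ ^ (g ^ (k * e + i)))
    (ψ : Polynomial ℂ) (hψ : ψ = ∏ i ∈ Finset.range e, (X - C (η i))) :
    (∀ i < e, ∀ j < e, i ≠ j → η i ≠ η j) ∧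
    ∃ q : Polynomial ℚ, q.map (algebraMap ℚ ℂ) = ψ ∧ Irreducible q ∧
      ∀ i < e, minpoly ℚ (η i) = q := by
  have hprim : IsPrimitiveRoot ζ p := hζ ▸ Complex.isPrimitiveRoot_exp p hp.ne_zero
  obtain rfl : η = fun i => gaussPeriod e f g i ζ := funext hη
  have hint : IsIntegral ℚ (gaussPeriod e f g 0 ζ) :=
    IsIntegral.sum _ fun _ _ => (hprim.isIntegral hp.pos).tower_top.pow _
  refine ⟨fun i hi j hj hij h => hij (gaussPeriod_injOn hp hf hpef hg hprim
    (by simpa using hi) (by simpa using hj) h), minpoly ℚ (gaussPeriod e f g 0 ζ), ?_,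
    minpoly.irreducible hint, fun i hi => ?_⟩
  · rw [hψ, map_minpoly_gaussPeriod hp he hf hpef hg hprim]
  · have hmem : gaussPeriod e f g i ζ ∈ (minpoly ℚ (gaussPeriod e f g 0 ζ)).rootSet ℂ := by
      rw [rootSet_minpoly_gaussPeriod hp he hpef hg hprim]
      exact ⟨i, by simpa using hi, rfl⟩
    exact (minpoly.eq_of_irreducible_of_monic (minpoly.irreducible hint)
      (mem_rootSet.1 hmem).2 (minpoly.monic hint)).symm
end

section
/- The polynomial ψ_8(X) = X^8 + X^7 − 7X^6 − 6X^5 + 15X^4 + 10X^3 − 10X^2 − 4X + 1 is the minimal polynomial over ℚ of the real number 2·cos(2π/17); in particular the field extension ℚ(2·cos(2π/17))/ℚ has degree 8. -/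
open Polynomial

/-- The translate by `2` of the octic period polynomial of the prime `17`. -/
noncomputable def shiftedOctic : ℤ[X] :=
  X ^ 8 + 17 * X ^ 7 + 119 * X ^ 6 + 442 * X ^ 5 + 935 * X ^ 4 + 1122 * X ^ 3
    + 714 * X ^ 2 + 204 * X + 17

theorem shiftedOctic_natDegree : shiftedOctic.natDegree = 8 := by
  unfold shiftedOctic
  compute_degree!

theorem shiftedOctic_monic : shiftedOctic.Monic := by
  unfold shiftedOctic
  monicity!

theorem shiftedOctic_irreducible : Irreducible shiftedOctic := by
  have hp : Prime (17 : ℤ) := by norm_num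
  have hP : (Ideal.span {(17 : ℤ)}).IsPrime :=
    (Ideal.span_singleton_prime (by norm_num)).2 hp
  refine (shiftedOctic_monic.isEisensteinAt_of_mem_of_notMem hP.ne_top ?_ ?_).irreducible hP
    shiftedOctic_monic.isPrimitive (by rw [shiftedOctic_natDegree]; norm_num)
  · intro n hn
    rw [shiftedOctic_natDegree] at hn
    rw [Ideal.mem_span_singleton]
    interval_cases n <;> simp [shiftedOctic, coeff_X, coeff_ofNat_mul, coeff_X_pow,
      coeff_ofNat_succ]
  · rw [Ideal.span_singleton_pow, Ideal.mem_span_singleton]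
    simp [shiftedOctic]

/-- `2 cos(2π/17)` is a root of the octic, since `cos 9θ = cos 8θ` and `cos θ ≠ 1`
for `θ = 2π/17`. -/
theorem octic_two_cos_eq_zero {c : ℝ} (hc : c = 2 * Real.cos (2 * Real.pi / 17)) :
    c ^ 8 + c ^ 7 - 7 * c ^ 6 - 6 * c ^ 5 + 15 * c ^ 4 + 10 * c ^ 3 - 10 * c ^ 2 - 4 * c + 1
      = 0 := by
  set θ : ℝ := 2 * Real.pi / 17 with hθ
  have h98 : Real.cos (3 * (3 * θ)) = Real.cos (2 * (2 * (2 * θ))) := by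
    rw [← Real.cos_two_pi_sub]
    congr 1
    rw [hθ]
    ring
  have hne : c - 2 ≠ 0 := by
    have hlt : Real.cos θ < Real.cos 0 :=
      Real.cos_lt_cos_of_nonneg_of_le_pi le_rfl
        (by rw [hθ]; linarith [Real.pi_pos]) (by rw [hθ]; linarith [Real.pi_pos])
    rw [Real.cos_zero] at hlt
    linarith
  simp only [Real.cos_three_mul, Real.cos_two_mul] at h98
  apply mul_left_cancel₀ hne
  rw [hc]
  linear_combination 2 * h98

theorem minpoly_two_cos_sub_two :
    minpoly ℚ (2 * Real.cos (2 * Real.pi / 17) - algebraMap ℚ ℝ 2)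
      = shiftedOctic.map (algebraMap ℤ ℚ) := by
  refine (minpoly.eq_of_irreducible_of_monic
    (shiftedOctic_monic.irreducible_iff_irreducible_map_fraction_map.1 shiftedOctic_irreducible)
    ?_ (shiftedOctic_monic.map _)).symm
  have h := octic_two_cos_eq_zero rfl
  simp only [shiftedOctic, Polynomial.map_add, Polynomial.map_mul, Polynomial.map_pow, map_X,
    Polynomial.map_ofNat, map_add, map_mul, map_pow, aeval_X, map_ofNat]
  linear_combination h

/-- The octic `ψ_8(X) = X^8 + X^7 − 7X^6 − 6X^5 + 15X^4 + 10X^3 − 10X^2 − 4X + 1` is the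
minimal polynomial over `ℚ` of `2 cos(2π/17)`; in particular `ℚ(2 cos(2π/17))` has degree 8
over `ℚ`. -/
theorem minpoly_two_cos_two_pi_div_seventeen (ψ : Polynomial ℚ)
    (hψ : ψ = X ^ 8 + X ^ 7 - 7 * X ^ 6 - 6 * X ^ 5 + 15 * X ^ 4 + 10 * X ^ 3
        - 10 * X ^ 2 - 4 * X + 1)
    (K : IntermediateField ℚ ℝ)
    (hK : K = IntermediateField.adjoin ℚ {2 * Real.cos (2 * Real.pi / 17)}) :
    minpoly ℚ (2 * Real.cos (2 * Real.pi / 17)) = ψ ∧ Module.finrank ℚ K = 8 := by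
  have hmin : minpoly ℚ (2 * Real.cos (2 * Real.pi / 17)) = ψ := by
    have h := minpoly.add_algebraMap (2 * Real.cos (2 * Real.pi / 17) - algebraMap ℚ ℝ 2) (2 : ℚ)
    rw [sub_add_cancel, minpoly_two_cos_sub_two] at h
    rw [h, hψ]
    simp only [shiftedOctic, Polynomial.map_add, Polynomial.map_mul, Polynomial.map_pow, map_X,
      Polynomial.map_ofNat, add_comp, mul_comp, pow_comp, X_comp, ofNat_comp, map_ofNat]
    ring
  refine ⟨hmin, ?_⟩
  have hdeg : ψ.natDegree = 8 := by
    rw [hψ]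
    compute_degree!
  have hint : IsIntegral ℚ (2 * Real.cos (2 * Real.pi / 17)) := by
    by_contra hn
    rw [minpoly.eq_zero hn] at hmin
    simp [← hmin] at hdeg
  rw [hK, IntermediateField.adjoin.finrank hint, hmin, hdeg]
end

section
/- Let p be an odd prime, let ζ be a primitive p-th root of unity, and let K = ℚ(ζ + ζ^{−1}) be the maximal real subfield of the p-th cyclotomic field. Then the ring of integers of K equals ℤ[ζ + ζ^{−1}], i.e., the ℤ-subalgebra generated by ζ + ζ^{−1} is the integral closure of ℤ in K; in other words the period equation of degree e = (p−1)/2 with f = 2 is monogenic. -/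
/-- The integers of the `p`-th cyclotomic field, realised in `ℂ`, lie in `ℤ[ζ]`. -/
theorem IsPrimitiveRoot.mem_adjoin_int_of_isIntegral {p : ℕ} (hp : p.Prime) {ζ : ℂ}
    (hζ : IsPrimitiveRoot ζ p) {x : ℂ} (hx : x ∈ IntermediateField.adjoin ℚ ({ζ} : Set ℂ))
    (hint : IsIntegral ℤ x) : x ∈ Algebra.adjoin ℤ ({ζ} : Set ℂ) := by
  have : Fact p.Prime := ⟨hp⟩
  have : NeZero p := ⟨hp.ne_zero⟩
  let L := IntermediateField.adjoin ℚ ({ζ} : Set ℂ)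
  have hζalg : IsAlgebraic ℚ ζ := ((hζ.isIntegral hp.pos).tower_top (A := ℚ)).isAlgebraic
  have : IsCyclotomicExtension {p} ℚ L := by
    change IsCyclotomicExtension {p} ℚ L.toSubalgebra
    rw [IntermediateField.adjoin_simple_toSubalgebra_of_isAlgebraic hζalg]
    exact hζ.adjoin_isCyclotomicExtension ℚ
  let z : L := ⟨ζ, IntermediateField.mem_adjoin_simple_self ℚ ζ⟩
  let f : L →ₐ[ℤ] ℂ := L.val.restrictScalars ℤ
  have hf : Function.Injective f := L.val.injective
  have hz : IsPrimitiveRoot z p := IsPrimitiveRoot.of_map_of_injective (f := f) hζ hf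
  have hcl := IsCyclotomicExtension.Rat.isIntegralClosure_adjoin_singleton_of_prime hz
  have hxL : IsIntegral ℤ (⟨x, hx⟩ : L) := (isIntegral_algHom_iff f hf).1 hint
  obtain ⟨y, hy⟩ := hcl.isIntegral_iff.1 hxL
  have hmem : f (algebraMap _ L y) ∈ (Algebra.adjoin ℤ ({z} : Set L)).map f :=
    ⟨_, y.2, rfl⟩
  rw [hy, AlgHom.map_adjoin_singleton] at hmem
  exact hmem

open Polynomial in
/-- Every element of `ℤ[ζ]` is an integral combination of `1, ζ, …, ζ ^ (p - 2)`. -/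
theorem IsPrimitiveRoot.exists_eq_sum_of_mem_adjoin_int {p : ℕ} (hp : p.Prime) {ζ : ℂ}
    (hζ : IsPrimitiveRoot ζ p) {x : ℂ} (hx : x ∈ Algebra.adjoin ℤ ({ζ} : Set ℂ)) :
    ∃ a : ℕ → ℤ, x = ∑ i ∈ Finset.range (p - 1), (a i : ℂ) * ζ ^ i := by
  rw [Algebra.adjoin_singleton_eq_range_aeval] at hx
  obtain ⟨R, rfl⟩ := hx
  have hdeg : (cyclotomic p ℤ).natDegree = p - 1 := by
    rw [natDegree_cyclotomic, Nat.totient_prime hp]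
  have hne : cyclotomic p ℤ ≠ 1 := fun h ↦ by
    rw [h, natDegree_one] at hdeg
    have := hp.two_le
    lia
  have hlt := natDegree_modByMonic_lt R (cyclotomic.monic p ℤ) hne
  have heval : aeval ζ (R %ₘ cyclotomic p ℤ) = aeval ζ R := by
    rw [cyclotomic_eq_minpoly hζ hp.pos]
    exact minpoly.aeval_modByMonic_minpoly R ζ
  refine ⟨(R %ₘ cyclotomic p ℤ).coeff, ?_⟩
  change aeval ζ R = _
  rw [← heval, aeval_eq_sum_range' (hdeg ▸ hlt)]
  simp only [zsmul_eq_mul]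

open Polynomial in
/-- The powers `1, ζ, …, ζ ^ (p - 2)` are linearly independent over `ℤ`. -/
theorem IsPrimitiveRoot.coeff_eq_of_sum_eq {p : ℕ} (hp : p.Prime) {ζ : ℂ}
    (hζ : IsPrimitiveRoot ζ p) {a b : ℕ → ℤ}
    (h : ∑ i ∈ Finset.range (p - 1), (a i : ℂ) * ζ ^ i =
      ∑ i ∈ Finset.range (p - 1), (b i : ℂ) * ζ ^ i) {i : ℕ} (hi : i < p - 1) : a i = b i := by
  let R : ℤ[X] := ∑ i ∈ Finset.range (p - 1), C (a i - b i) * X ^ i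
  have hdeg : R.degree < (p - 1 : ℕ) := by
    rw [← mem_degreeLT]
    refine sum_mem fun i hi ↦ mem_degreeLT.2 ((degree_C_mul_X_pow_le _ _).trans_lt ?_)
    exact_mod_cast Finset.mem_range.1 hi
  have heval : aeval ζ R = 0 := by simp [R, sub_mul, h]
  have hR : R = 0 := by
    refine eq_zero_of_dvd_of_degree_lt (p := cyclotomic p ℤ) ?_ ?_
    · rw [cyclotomic_eq_minpoly hζ hp.pos]
      exact minpoly.isIntegrallyClosed_dvd (hζ.isIntegral hp.pos) heval
    · rwa [degree_cyclotomic, Nat.totient_prime hp]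
  have hcoeff : R.coeff i = a i - b i := by
    simp only [R, finsetSum_coeff, coeff_C_mul_X_pow]
    simp [hi]
  rw [← sub_eq_zero, ← hcoeff, hR, coeff_zero]

theorem pow_add_inv_pow_mem_adjoin {R F : Type*} [CommRing R] [Field F] [Algebra R F] {z : F}
    (hz : z ≠ 0) (n : ℕ) : z ^ n + z⁻¹ ^ n ∈ Algebra.adjoin R ({z + z⁻¹} : Set F) := by
  have hθ : z + z⁻¹ ∈ Algebra.adjoin R ({z + z⁻¹} : Set F) :=
    Algebra.self_mem_adjoin_singleton R _
  induction n using Nat.twoStepInduction with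
  | zero => simpa using add_mem (one_mem _) (one_mem _)
  | one => simpa only [pow_one] using hθ
  | more n ih₀ ih₁ =>
    have h : z ^ (n + 2) + z⁻¹ ^ (n + 2) =
        (z + z⁻¹) * (z ^ (n + 1) + z⁻¹ ^ (n + 1)) - (z ^ n + z⁻¹ ^ n) := by
      have := mul_inv_cancel₀ hz
      linear_combination (-(z ^ n + z⁻¹ ^ n)) * this
    rw [h]
    exact sub_mem (mul_mem hθ ih₁) ih₀

/-- An element of `ℤ[ζ]` fixed by complex conjugation lies in `ℤ[ζ + ζ⁻¹]`. -/
theorem IsPrimitiveRoot.mem_adjoin_add_inv_of_conj_eq {p : ℕ} (hp : p.Prime) (hodd : Odd p)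
    {ζ : ℂ} (hζ : IsPrimitiveRoot ζ p) {x : ℂ} (hx : x ∈ Algebra.adjoin ℤ ({ζ} : Set ℂ))
    (hconj : starRingEnd ℂ x = x) : x ∈ Algebra.adjoin ℤ ({ζ + ζ⁻¹} : Set ℂ) := by
  have hζ0 : ζ ≠ 0 := hζ.ne_zero hp.ne_zero
  obtain ⟨e, rfl⟩ := hodd
  have hinv : ζ⁻¹ = ζ ^ (2 * e) :=
    inv_eq_of_mul_eq_one_right (by rw [← pow_succ', hζ.pow_eq_one])
  have hcζ : starRingEnd ℂ ζ = ζ⁻¹ :=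
    (Complex.inv_eq_conj (Complex.norm_eq_one_of_pow_eq_one hζ.pow_eq_one hp.ne_zero)).symm
  have hmem : ζ⁻¹ * x ∈ Algebra.adjoin ℤ ({ζ} : Set ℂ) :=
    mul_mem (hinv ▸ pow_mem (Algebra.self_mem_adjoin_singleton ℤ ζ) _) hx
  obtain ⟨a, ha⟩ := hζ.exists_eq_sum_of_mem_adjoin_int hp hmem
  rw [Nat.add_sub_cancel] at ha
  have hxa : x = ζ * ∑ i ∈ Finset.range (2 * e), (a i : ℂ) * ζ ^ i := by
    rw [← ha, mul_inv_cancel_left₀ hζ0]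
  have hpow : ∀ i < 2 * e, ζ⁻¹ ^ (i + 1) = ζ * ζ ^ (2 * e - 1 - i) := fun i hi ↦ by
    rw [inv_pow, ← pow_succ']
    refine inv_eq_of_mul_eq_one_right ?_
    rw [← pow_add, show i + 1 + (2 * e - 1 - i + 1) = 2 * e + 1 by lia, hζ.pow_eq_one]
  have hxa' : x = ζ * ∑ i ∈ Finset.range (2 * e), (a (2 * e - 1 - i) : ℂ) * ζ ^ i := by
    rw [← Finset.sum_range_reflect, Finset.mul_sum, ← hconj, hxa, map_mul, map_sum,
      Finset.mul_sum, hcζ]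
    refine Finset.sum_congr rfl fun i hi ↦ ?_
    rw [Finset.mem_range] at hi
    rw [map_mul, map_pow, hcζ, map_intCast, show 2 * e - 1 - (2 * e - 1 - i) = i by lia,
      mul_left_comm, ← pow_succ', hpow i hi, mul_left_comm]
  have hsymm : ∀ i < 2 * e, a i = a (2 * e - 1 - i) := fun i hi ↦
    hζ.coeff_eq_of_sum_eq hp (b := fun i ↦ a (2 * e - 1 - i))
      (mul_left_cancel₀ hζ0 (hxa.symm.trans hxa')) hi
  have hfold : x = ∑ i ∈ Finset.range e, a i • (ζ ^ (i + 1) + ζ⁻¹ ^ (i + 1)) := by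
    rw [hxa, two_mul, Finset.sum_range_add, mul_add, Finset.mul_sum, Finset.mul_sum,
      ← Finset.sum_range_reflect (fun i ↦ ζ * ((a (e + i) : ℂ) * ζ ^ (e + i))),
      ← Finset.sum_add_distrib]
    refine Finset.sum_congr rfl fun i hi ↦ ?_
    rw [Finset.mem_range] at hi
    rw [hpow i (by lia), show e + (e - 1 - i) = 2 * e - 1 - i by lia, ← hsymm i (by lia),
      zsmul_eq_mul]
    ring
  rw [hfold]
  exact sum_mem fun i _ ↦ zsmul_mem (pow_add_inv_pow_mem_adjoin hζ0 _) _

/-- For an odd prime `p` and a primitive `p`-th root of unity `ζ`, the ring of integers of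
the maximal real subfield `K = ℚ(ζ + ζ⁻¹)` of the `p`-th cyclotomic field equals
`ℤ[ζ + ζ⁻¹]`: the elements of `K` that are integral over `ℤ` are exactly the elements of
the `ℤ`-subalgebra generated by `ζ + ζ⁻¹`. -/
theorem ringOfIntegers_maximal_real_subfield (p : ℕ) (hp : p.Prime) (hodd : Odd p)
    (ζ : ℂ) (hζ : IsPrimitiveRoot ζ p)
    (K : IntermediateField ℚ ℂ) (hK : K = IntermediateField.adjoin ℚ {ζ + ζ⁻¹}) :
    {x : ℂ | x ∈ K ∧ IsIntegral ℤ x} = ↑(Algebra.adjoin ℤ ({ζ + ζ⁻¹} : Set ℂ)) := by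
  subst hK
  have hcζ : starRingEnd ℂ ζ = ζ⁻¹ :=
    (Complex.inv_eq_conj (Complex.norm_eq_one_of_pow_eq_one hζ.pow_eq_one hp.ne_zero)).symm
  ext x
  constructor
  · rintro ⟨hxK, hint⟩
    have hle : IntermediateField.adjoin ℚ {ζ + ζ⁻¹} ≤ IntermediateField.adjoin ℚ {ζ} := by
      rw [IntermediateField.adjoin_simple_le_iff]
      have h := IntermediateField.mem_adjoin_simple_self ℚ ζ
      exact add_mem h (inv_mem h)
    have hconj : starRingEnd ℂ x = x := by
      clear hint
      induction hxK using IntermediateField.adjoin_induction with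
      | mem y hy =>
        rw [Set.mem_singleton_iff.1 hy, map_add, map_inv₀, hcζ, inv_inv, add_comm]
      | algebraMap q => simp
      | add y z _ _ hy hz => rw [map_add, hy, hz]
      | inv y _ hy => rw [map_inv₀, hy]
      | mul y z _ _ hy hz => rw [map_mul, hy, hz]
    exact hζ.mem_adjoin_add_inv_of_conj_eq hp hodd
      (hζ.mem_adjoin_int_of_isIntegral hp (hle hxK) hint) hconj
  · intro hx
    have hζint : IsIntegral ℤ ζ := hζ.isIntegral hp.pos
    have hθint : IsIntegral ℤ (ζ + ζ⁻¹) := hζint.add (hζ.inv.isIntegral hp.pos)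
    refine ⟨?_, ?_⟩
    · have h : Algebra.adjoin ℤ {ζ + ζ⁻¹} ≤
          (IntermediateField.adjoin ℚ {ζ + ζ⁻¹}).toSubalgebra.restrictScalars ℤ :=
        Algebra.adjoin_le (Set.singleton_subset_iff.2
          (IntermediateField.mem_adjoin_simple_self ℚ (ζ + ζ⁻¹)))
      exact h hx
    · exact adjoin_le_integralClosure hθint hx
end

section
/- Let p ≥ 5 be a prime, let ζ be a primitive p-th root of unity, and let K = ℚ(ζ + ζ^{−1}) be the maximal real subfield of the p-th cyclotomic field, a number field of degree e = (p−1)/2 over ℚ. Then the field discriminant of K equals p^{e−1} = p^{(p−3)/2}. -/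
open NumberField Polynomial

section AddInv

variable {n : ℕ} [NeZero n] {K L : Type*} [Field K] [NumberField K] [Field L] [NumberField L]
  [Algebra K L] {ζ : L} {a : K}

/-- A number field generated by `ζ + ζ⁻¹`, with `ζ` a root of unity, is totally real. -/
theorem isTotallyReal_of_algebraMap_eq_add_inv (hζ : IsPrimitiveRoot ζ n)
    (ha : algebraMap K L a = ζ + ζ⁻¹) (htop : IntermediateField.adjoin ℚ {a} = ⊤) :
    IsTotallyReal K where
  isReal v := by
    rw [InfinitePlace.isReal_iff, ComplexEmbedding.isReal_iff]
    set φ := v.embedding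
    have key : ComplexEmbedding.conjugate φ a = φ a := by
      rw [ComplexEmbedding.conjugate_coe_eq, ← ComplexEmbedding.lift_algebraMap_apply L φ a, ha,
        map_add, map_inv₀, map_add, map_inv₀]
      have h1 : ‖ComplexEmbedding.lift L φ ζ‖ = 1 :=
        (hζ.map_of_injective (ComplexEmbedding.lift L φ).injective).norm'_eq_one (NeZero.ne n)
      rw [← Complex.inv_eq_conj h1, inv_inv, add_comm]
    ext x
    have hx : x ∈ IntermediateField.adjoin ℚ {a} := htop ▸ IntermediateField.mem_top
    induction hx using IntermediateField.adjoin_induction with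
    | mem x hx => rwa [Set.mem_singleton_iff.1 hx]
    | algebraMap x => simp
    | add x y _ _ hx hy => rw [map_add, map_add, hx, hy]
    | inv x _ hx => rw [map_inv₀, map_inv₀, hx]
    | mul x y _ _ hx hy => rw [map_mul, map_mul, hx, hy]

/-- Over a totally real field containing `a = ζ + ζ⁻¹`, a root of unity `ζ` of order greater than
`2` has minimal polynomial `X ^ 2 - a X + 1`. -/
theorem minpoly_eq_of_algebraMap_eq_add_inv [IsTotallyReal K] (hζ : IsPrimitiveRoot ζ n)
    (hn : 2 < n) (ha : algebraMap K L a = ζ + ζ⁻¹) :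
    minpoly K ζ = X ^ 2 - C a * X + 1 := by
  have hζ0 : ζ ≠ 0 := hζ.ne_zero (NeZero.ne n)
  have hmonic : (X ^ 2 - C a * X + 1 : K[X]).Monic := by monicity!
  have hdeg : (X ^ 2 - C a * X + 1 : K[X]).natDegree = 2 := by compute_degree!
  have hdvd : minpoly K ζ ∣ X ^ 2 - C a * X + 1 := by
    apply minpoly.dvd
    simp only [map_add, map_sub, map_mul, map_pow, aeval_X, aeval_C, map_one, ha]
    field_simp
    ring
  have hint : IsIntegral K ζ := Algebra.IsIntegral.isIntegral ζ
  refine (eq_of_monic_of_dvd_of_natDegree_le (minpoly.monic hint) hmonic hdvd ?_).symm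
  rw [hdeg, minpoly.two_le_natDegree_iff hint]
  rintro ⟨x, hx⟩
  have φ : L →+* ℂ := Classical.arbitrary _
  have hreal := IsTotallyReal.complexEmbedding_isReal (φ.comp (algebraMap K L))
  rw [ComplexEmbedding.isReal_iff] at hreal
  have h1 := RingHom.congr_fun hreal x
  rw [ComplexEmbedding.conjugate_coe_eq] at h1
  have h2 : φ ζ ^ 2 = 1 := by
    have hζφ := hζ.map_of_injective φ.injective
    have h3 : ‖φ ζ‖ = 1 := hζφ.norm'_eq_one (NeZero.ne n)
    have h4 := Complex.inv_eq_conj h3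
    simp only [RingHom.comp_apply, hx] at h1
    rw [h1] at h4
    rw [pow_two]
    nth_rewrite 1 [← h4]
    exact inv_mul_cancel₀ (hζφ.ne_zero (NeZero.ne n))
  have h5 : ζ ^ 2 = 1 := φ.injective (by simpa using h2)
  exact absurd (Nat.le_of_dvd two_pos (hζ.dvd_of_pow_eq_one 2 h5)) (by lia)

theorem adjoin_eq_top_of_isCyclotomicExtension [IsCyclotomicExtension {n} ℚ L]
    (hζ : IsPrimitiveRoot ζ n) : Algebra.adjoin K {ζ} = ⊤ := by
  have h := IsCyclotomicExtension.adjoin_primitive_root_eq_top (A := ℚ) hζ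
  rw [eq_top_iff]
  intro x _
  have hx : x ∈ Algebra.adjoin ℚ {ζ} := h ▸ Algebra.mem_top
  induction hx using Algebra.adjoin_induction with
  | mem x hx => exact Algebra.subset_adjoin hx
  | algebraMap x =>
    rw [IsScalarTower.algebraMap_apply ℚ K L]
    exact Subalgebra.algebraMap_mem _ _
  | add x y _ _ hx hy => exact add_mem (hx trivial) (hy trivial)
  | mul x y _ _ hx hy => exact mul_mem (hx trivial) (hy trivial)

theorem finrank_eq_two_of_algebraMap_eq_add_inv [IsTotallyReal K] [IsCyclotomicExtension {n} ℚ L]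
    (hζ : IsPrimitiveRoot ζ n) (hn : 2 < n) (ha : algebraMap K L a = ζ + ζ⁻¹) :
    Module.finrank K L = 2 := by
  have hint : IsIntegral K ζ := Algebra.IsIntegral.isIntegral ζ
  have htop : IntermediateField.adjoin K {ζ} = ⊤ := by
    rw [← IntermediateField.toSubalgebra_inj,
      IntermediateField.adjoin_simple_toSubalgebra_of_isAlgebraic hint.isAlgebraic,
      adjoin_eq_top_of_isCyclotomicExtension hζ, IntermediateField.top_toSubalgebra]
  rw [← IntermediateField.finrank_top', ← htop, IntermediateField.adjoin.finrank hint,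
    minpoly_eq_of_algebraMap_eq_add_inv hζ hn ha]
  compute_degree!

end AddInv

section Prime

variable {p : ℕ} [hp : Fact p.Prime] {K L : Type*} [Field K] [NumberField K] [Field L]
  [NumberField L] [Algebra K L] [IsCyclotomicExtension {p} ℚ L] {ζ : L} {a : K}

theorem absNorm_differentIdeal_dvd_of_algebraMap_eq_add_inv [IsTotallyReal K]
    (hζ : IsPrimitiveRoot ζ p) (h2 : 2 < p) (ha : algebraMap K L a = ζ + ζ⁻¹) :
    Ideal.absNorm (differentIdeal (𝓞 K) (𝓞 L)) ∣ p := by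
  have hζ0 : ζ ≠ 0 := hζ.ne_zero (NeZero.ne p)
  set z : 𝓞 L := hζ.toInteger
  have hint : IsIntegral (𝓞 K) z := Algebra.IsIntegral.isIntegral z
  have hmem := aeval_derivative_mem_differentIdeal (𝓞 K) K L z
    (adjoin_eq_top_of_isCyclotomicExtension hζ)
  have hz2 : IsPrimitiveRoot (ζ ^ 2) p :=
    hζ.pow_of_coprime 2 ((Nat.coprime_primes Nat.prime_two hp.out).2 h2.ne)
  have hder : z * aeval z (derivative (minpoly (𝓞 K) z)) = hz2.toInteger - 1 := by
    apply RingOfIntegers.ext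
    have hmap : aeval ζ (derivative (minpoly K ζ)) =
        algebraMap (𝓞 L) L (aeval z (derivative (minpoly (𝓞 K) z))) := by
      have : minpoly K ζ = (minpoly (𝓞 K) z).map (algebraMap (𝓞 K) K) :=
        minpoly.isIntegrallyClosed_eq_field_fractions K L hint
      rw [this, derivative_map, aeval_map_algebraMap, ← aeval_algebraMap_apply]
      rfl
    have : ζ * aeval ζ (derivative (minpoly K ζ)) = ζ ^ 2 - 1 := by
      rw [minpoly_eq_of_algebraMap_eq_add_inv hζ h2 ha]
      simp [ha]
      field_simp
      ring
    rw [hmap] at this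
    exact this
  have hspan := Ideal.absNorm_dvd_absNorm_of_le ((Ideal.span_singleton_le_iff_mem _).2
    (hder ▸ Ideal.mul_mem_left _ z hmem))
  rwa [Ideal.absNorm_span_singleton, hz2.norm_toInteger_sub_one_of_prime_ne_two' h2.ne',
    Int.natAbs_natCast] at hspan

theorem finrank_of_algebraMap_eq_add_inv [IsTotallyReal K]
    (hζ : IsPrimitiveRoot ζ p) (h2 : 2 < p) (ha : algebraMap K L a = ζ + ζ⁻¹) :
    Module.finrank ℚ K = (p - 1) / 2 := by
  have hmul := Module.finrank_mul_finrank ℚ K L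
  rw [finrank_eq_two_of_algebraMap_eq_add_inv hζ h2 ha, IsCyclotomicExtension.Rat.finrank p L,
    Nat.totient_prime hp.out] at hmul
  lia

theorem discr_of_algebraMap_eq_add_inv [IsTotallyReal K]
    (hζ : IsPrimitiveRoot ζ p) (h2 : 2 < p) (ha : algebraMap K L a = ζ + ζ⁻¹) :
    discr K = (p : ℤ) ^ ((p - 1) / 2 - 1) := by
  have hsign : (discr K).sign = 1 := by
    rw [sign_discr, IsTotallyReal.nrComplexPlaces_eq_zero, pow_zero]
  have habs : (discr K).natAbs = p ^ ((p - 1) / 2 - 1) := by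
    have hL : (discr L).natAbs = p ^ (p - 2) := by
      simp [IsCyclotomicExtension.Rat.discr_prime p L, Int.natAbs_mul, Int.natAbs_pow]
    have htower := natAbs_discr_eq_absNorm_differentIdeal_mul_natAbs_discr_pow K (𝓞 K) L (𝓞 L)
    rw [hL, finrank_eq_two_of_algebraMap_eq_add_inv hζ h2 ha] at htower
    have hodd : p % 2 = 1 := Nat.odd_iff.1 (hp.out.odd_of_ne_two h2.ne')
    obtain ⟨k, -, hk⟩ := (Nat.dvd_prime_pow hp.out).1
      ((dvd_pow_self _ two_ne_zero).trans (Dvd.intro_left _ htower.symm))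
    rw [hk, ← pow_mul] at htower
    rw [hk]
    rcases (Nat.dvd_prime hp.out).1
      (absNorm_differentIdeal_dvd_of_algebraMap_eq_add_inv hζ h2 ha) with h | h
    · rw [h, one_mul] at htower
      have := Nat.pow_right_injective hp.out.two_le htower
      lia
    · rw [h, ← pow_succ'] at htower
      have := Nat.pow_right_injective hp.out.two_le htower
      congr 1
      lia
  rw [← Int.sign_mul_natAbs (discr K), hsign, habs, one_mul, Nat.cast_pow]

end Prime

/-- For a prime `p ≥ 5` and a primitive `p`-th root of unity `ζ`, the field discriminant of
the maximal real subfield `K = ℚ(ζ + ζ⁻¹)` of the `p`-th cyclotomic field, a number field of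
degree `e = (p−1)/2` over `ℚ`, equals `p^{e−1} = p^{(p−3)/2}`. -/
theorem discr_maximal_real_subfield (p : ℕ) (hp : p.Prime) (hp5 : 5 ≤ p)
    (ζ : ℂ) (hζ : IsPrimitiveRoot ζ p)
    (K : IntermediateField ℚ ℂ) (hK : K = IntermediateField.adjoin ℚ {ζ + ζ⁻¹})
    [NumberField K] :
    Module.finrank ℚ K = (p - 1) / 2 ∧
    NumberField.discr K = (p : ℤ) ^ ((p - 1) / 2 - 1) := by
  have : Fact p.Prime := ⟨hp⟩
  let L := IntermediateField.adjoin ℚ {ζ}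
  have : IsCyclotomicExtension {p} ℚ L := by
    change IsCyclotomicExtension {p} ℚ (IntermediateField.adjoin ℚ {ζ}).toSubalgebra
    rw [IntermediateField.adjoin_simple_toSubalgebra_of_isAlgebraic
      (hζ.isIntegral hp.pos).tower_top.isAlgebraic]
    exact hζ.adjoin_isCyclotomicExtension ℚ
  have : NumberField L := IsCyclotomicExtension.numberField {p} ℚ L
  have hζL : ζ ∈ L := IntermediateField.mem_adjoin_simple_self ℚ ζ
  have hKL : K ≤ L := by
    rw [hK, IntermediateField.adjoin_simple_le_iff]
    exact add_mem hζL (inv_mem hζL)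
  let _ : Algebra K L := (IntermediateField.inclusion hKL).toRingHom.toAlgebra
  have haK : ζ + ζ⁻¹ ∈ K := hK ▸ IntermediateField.mem_adjoin_simple_self ℚ _
  have hζ' : IsPrimitiveRoot (⟨ζ, hζL⟩ : L) p := IsPrimitiveRoot.coe_submonoidClass_iff.1 hζ
  have ha : algebraMap K L ⟨ζ + ζ⁻¹, haK⟩ = (⟨ζ, hζL⟩ : L) + (⟨ζ, hζL⟩ : L)⁻¹ := rfl
  have htop : IntermediateField.adjoin ℚ {(⟨ζ + ζ⁻¹, haK⟩ : K)} = ⊤ := by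
    apply IntermediateField.lift_injective K
    exact (IntermediateField.lift_adjoin_simple ℚ K _).trans
      (hK.symm.trans (IntermediateField.lift_top ℚ K).symm)
  have : IsTotallyReal K := isTotallyReal_of_algebraMap_eq_add_inv hζ' ha htop
  exact ⟨finrank_of_algebraMap_eq_add_inv hζ' (by lia) ha,
    discr_of_algebraMap_eq_add_inv hζ' (by lia) ha⟩
end

section
/- Let p be a prime with p = e·f + 1 for positive integers e, f, and let K be the unique subfield of the p-th cyclotomic field ℚ(ζ_p) with [K : ℚ] = e (the field generated by the Gauss periods). Then the field discriminant Δ_e of K satisfies: Δ_e = −p^{e−1} if (e − 1) ≡ 1 (mod 4) and f is odd, and Δ_e = p^{e−1} otherwise. -/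
section

open NumberField Ideal

/-- The ramification index of a prime in a finite flat extension is at most the rank. -/
theorem Ideal.ramificationIdx_le_finrank_of_flat {R S : Type*} [CommRing R] [CommRing S]
    [Algebra R S] [IsDomain R] [Module.Finite R S] [Module.Flat R S] (q : Ideal S) [q.IsPrime] :
    q.ramificationIdx R ≤ Module.finrank R S := by
  have : Fintype ((q.under R).primesOver S) :=
    (Algebra.QuasiFinite.finite_primesOver (q.under R)).fintype
  rw [← sum_ramification_inertia_eq_finrank (q.under R) (S := S)]
  refine le_trans (Nat.le_mul_of_pos_right _ (Ideal.inertiaDeg_pos q R))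
    (Finset.single_le_sum
      (f := fun q : (q.under R).primesOver S ↦ q.1.ramificationIdx R * q.1.inertiaDeg R)
      (fun _ _ ↦ Nat.zero_le _)
      (Finset.mem_univ (⟨q, inferInstance, inferInstance⟩ : (q.under R).primesOver S)))

/-- A prime lying over the rational prime `p` has norm divisible by `p`. -/
theorem dvd_absNorm_of_liesOver {K : Type*} [Field K] [NumberField K] {p : ℕ}
    (P : Ideal (𝓞 K)) [P.IsPrime] [P.LiesOver (span {(p : ℤ)})] :
    p ∣ absNorm P := by
  rw [← Int.natCast_dvd_natCast, ← mem_span_singleton, P.over_def (span {(p : ℤ)}), mem_comap]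
  simpa using absNorm_mem P

open IsCyclotomicExtension.Rat in
/-- A subfield of degree `e` of the `p`-th cyclotomic field has discriminant `± p ^ (e - 1)`. -/
theorem natAbs_discr_of_algebra_cyclotomic {p : ℕ} [hp : Fact p.Prime] (K L : Type*) [Field K]
    [NumberField K] [Field L] [NumberField L] [Algebra K L] [IsCyclotomicExtension {p} ℚ L] :
    (discr K).natAbs = p ^ (Module.finrank ℚ K - 1) := by
  set e := Module.finrank ℚ K with he
  set f := Module.finrank K L with hf
  have hef : e * f = p - 1 := by
    rw [Module.finrank_mul_finrank, IsCyclotomicExtension.finrank (n := p) L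
      (Polynomial.cyclotomic.irreducible_rat hp.out.pos), Nat.totient_prime hp.out]
  have he0 : 0 < e := Module.finrank_pos
  have hf0 : 0 < f := Module.finrank_pos
  have hζ := IsCyclotomicExtension.zeta_spec p ℚ L
  set P : Ideal (𝓞 L) := span {hζ.toInteger - 1} with hP
  have : P.IsPrime := isPrime_span_zeta_sub_one' p hζ
  have : P.LiesOver (span {(p : ℤ)}) := by
    have : IsCyclotomicExtension {p ^ (0 + 1)} ℚ L := by simpa only [zero_add, pow_one]
    exact liesOver_span_zeta_sub_one p 0 (hζ := by simp [hζ])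
  let Q : Ideal (𝓞 K) := P.under (𝓞 K)
  have : Q.LiesOver (span {(p : ℤ)}) := LiesOver.tower_bot P Q _
  have hprod : Q.ramificationIdx ℤ * P.ramificationIdx (𝓞 K) = e * f := by
    rw [← ramificationIdx_tower, hef, ramificationIdx_span_zeta_sub_one']
  have hle₁ : Q.ramificationIdx ℤ ≤ e := by
    simpa [he, RingOfIntegers.rank] using Q.ramificationIdx_le_finrank_of_flat (R := ℤ)
  have hle₂ : P.ramificationIdx (𝓞 K) ≤ f := by
    rw [hf, IsFractionRing.finrank_eq (𝓞 K) K (𝓞 L) L]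
    exact P.ramificationIdx_le_finrank_of_flat (R := 𝓞 K)
  have h₁ : Q.ramificationIdx ℤ = e := by nlinarith
  have h₂ : P.ramificationIdx (𝓞 K) = f := by nlinarith
  have hp0 : span {(p : ℤ)} ≠ ⊥ := by simpa using hp.out.ne_zero
  have hQ0 : Q ≠ ⊥ := ne_bot_of_liesOver_of_ne_bot hp0 Q
  have : (span {(p : ℤ)}).IsMaximal := Int.ideal_span_isMaximal_of_prime p
  have : Q.IsMaximal := IsPrime.isMaximal inferInstance hQ0
  have hd₁ : Q ^ (e - 1) ∣ differentIdeal ℤ (𝓞 K) := by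
    refine pow_sub_one_dvd_differentIdeal ℤ Q e hp0 ?_
    rw [← h₁, IsDedekindDomain.ramificationIdx_eq_multiplicity (span {(p : ℤ)}) Q
      (map_ne_bot_of_ne_bot hp0)]
    exact pow_multiplicity_dvd _ _
  have hd₂ : P ^ (f - 1) ∣ differentIdeal (𝓞 K) (𝓞 L) := by
    refine pow_sub_one_dvd_differentIdeal (𝓞 K) P f hQ0 ?_
    rw [← h₂, IsDedekindDomain.ramificationIdx_eq_multiplicity Q P
      (map_ne_bot_of_ne_bot hQ0)]
    exact pow_multiplicity_dvd _ _
  obtain ⟨a, ha⟩ : p ^ (e - 1) ∣ (discr K).natAbs := by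
    rw [← absNorm_differentIdeal K (𝓞 K)]
    refine (pow_dvd_pow_of_dvd (dvd_absNorm_of_liesOver Q) _).trans ?_
    simpa using map_dvd absNorm hd₁
  obtain ⟨b, hb⟩ : p ^ (f - 1) ∣ absNorm (differentIdeal (𝓞 K) (𝓞 L)) := by
    refine (pow_dvd_pow_of_dvd (dvd_absNorm_of_liesOver P) _).trans ?_
    simpa using map_dvd absNorm hd₂
  have key := natAbs_discr_eq_absNorm_differentIdeal_mul_natAbs_discr_pow K (𝓞 K) L (𝓞 L)
  rw [discr_prime p L, ha, hb, Int.natAbs_mul, Int.natAbs_pow, Int.natAbs_pow] at key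
  simp only [Int.natAbs_neg, Int.natAbs_one, one_pow, one_mul, Int.natAbs_natCast] at key
  have hexp : p - 2 = (f - 1) + (e - 1) * f := by
    obtain ⟨e', he'⟩ := Nat.exists_eq_add_of_lt he0
    obtain ⟨f', hf'⟩ := Nat.exists_eq_add_of_lt hf0
    have : p = e * f + 1 := by have := hp.out.pos; omega
    rw [this, he', hf']
    simp only [zero_add, Nat.add_sub_cancel]
    ring_nf
    omega
  have : b * a ^ f = 1 := by
    refine Nat.eq_of_mul_eq_mul_left (pow_pos hp.out.pos (p - 2)) ?_
    rw [mul_one]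
    conv_rhs => rw [key]
    rw [hexp]
    ring
  have ha1 : a = 1 := (pow_eq_one_iff.mp (Nat.eq_one_of_mul_eq_one_left this)).resolve_right hf0.ne'
  rw [ha, ha1, mul_one]

/-- A subfield of even codegree in the `p`-th cyclotomic field is totally real. -/
theorem isTotallyReal_of_algebra_cyclotomic {p : ℕ} [hp : Fact p.Prime] (K L : Type*) [Field K]
    [NumberField K] [Field L] [NumberField L] [Algebra K L] [IsCyclotomicExtension {p} ℚ L]
    (hf : Even (Module.finrank K L)) : IsTotallyReal K := by
  have : IsGalois ℚ L := IsCyclotomicExtension.isGalois {p} ℚ L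
  have : IsGalois K L := IsGalois.tower_top_of_isGalois ℚ K L
  have hζ := IsCyclotomicExtension.zeta_spec p ℚ L
  set ζ := IsCyclotomicExtension.zeta p ℚ L
  obtain ⟨σ, hσ⟩ : ∃ σ : Gal(L/K), orderOf σ = 2 := by
    have : Fact (Nat.Prime 2) := ⟨Nat.prime_two⟩
    apply exists_prime_orderOf_dvd_card'
    rw [IsGalois.card_aut_eq_finrank]
    exact hf.two_dvd
  have hσ2 : σ (σ ζ) = ζ := by
    rw [← AlgEquiv.mul_apply, ← pow_two, ← hσ, pow_orderOf_eq_one, AlgEquiv.one_apply]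
  have hσ1 : σ ≠ 1 := by rintro rfl; simp at hσ
  have hinv : ζ * σ ζ = 1 := by
    by_contra hne
    have hη : IsPrimitiveRoot (ζ * σ ζ) p :=
      IsPrimitiveRoot.iff_orderOf.mpr <| orderOf_eq_prime
        (by rw [mul_pow, ← map_pow, hζ.pow_eq_one, map_one, mul_one]) hne
    refine hσ1 (AlgEquiv.ext fun x ↦ ?_)
    have : (σ : L →ₐ[K] L).restrictScalars ℚ = AlgHom.id ℚ L :=
      (hη.powerBasis ℚ).algHom_ext (by simp [hσ2, mul_comm])
    simpa using DFunLike.congr_fun this x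
  refine ⟨fun v ↦ ?_⟩
  obtain ⟨w, rfl⟩ := InfinitePlace.comap_surjective (K := L) v
  dsimp only
  rw [← w.mk_embedding, InfinitePlace.comap_mk, InfinitePlace.isReal_mk_iff]
  refine ComplexEmbedding.IsConj.isReal_comp (σ := σ) ?_
  have : (ComplexEmbedding.conjugate w.embedding).toRatAlgHom =
      (w.embedding.comp (σ : L →+* L)).toRatAlgHom := by
    refine (hζ.powerBasis ℚ).algHom_ext ?_
    have h : ‖w.embedding ζ‖ = 1 :=
      Complex.norm_eq_one_of_pow_eq_one (n := p) (by rw [← map_pow, hζ.pow_eq_one, map_one])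
        hp.out.ne_zero
    simp [eq_inv_of_mul_eq_one_right hinv, Complex.inv_eq_conj h]
  exact RingHom.ext fun x ↦ DFunLike.congr_fun this x

/-- For `p > 2`, a subfield of odd codegree in the `p`-th cyclotomic field is totally complex. -/
theorem isTotallyComplex_of_algebra_cyclotomic {p : ℕ} [hp : Fact p.Prime] (hp2 : 2 < p)
    (K L : Type*) [Field K] [NumberField K] [Field L] [NumberField L] [Algebra K L]
    [IsCyclotomicExtension {p} ℚ L] (hf : Odd (Module.finrank K L)) : IsTotallyComplex K := by
  have : IsGalois ℚ L := IsCyclotomicExtension.isGalois {p} ℚ L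
  have : IsGalois K L := IsGalois.tower_top_of_isGalois ℚ K L
  have := IsUnramifiedAtInfinitePlaces_of_odd_finrank hf
  have := IsCyclotomicExtension.Rat.isTotallyComplex L hp2
  refine ⟨fun v ↦ ?_⟩
  obtain ⟨w, rfl⟩ := InfinitePlace.comap_surjective (K := L) v
  exact (InfinitePlace.isUnramified_iff.mp (InfinitePlace.isUnramified K w)).resolve_left
    (InfinitePlace.not_isReal_iff_isComplex.mpr (IsTotallyComplex.isComplex w))

end

/-- For a prime `p = e·f + 1`, the field discriminant `Δ_e` of the unique subfield `K` of
degree `e` of the `p`-th cyclotomic field (the field generated by the Gauss periods)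
satisfies: `Δ_e = −p^{e−1}` if `(e − 1) ≡ 1 (mod 4)` and `f` is odd, and `Δ_e = p^{e−1}`
otherwise. -/
theorem discr_period_field (p e f : ℕ) (hp : p.Prime)
    (he : 0 < e) (hf : 0 < f) (hpef : p = e * f + 1)
    (ζ : ℂ) (hζ : IsPrimitiveRoot ζ p)
    (K : IntermediateField ℚ ℂ) (hKle : K ≤ IntermediateField.adjoin ℚ {ζ})
    (hdeg : Module.finrank ℚ K = e) [NumberField K] :
    NumberField.discr K =
      if (e - 1) % 4 = 1 ∧ f % 2 = 1 then -(p : ℤ) ^ (e - 1) else (p : ℤ) ^ (e - 1) := by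
  have : Fact p.Prime := ⟨hp⟩
  let L := IntermediateField.adjoin ℚ {ζ}
  have hL : IsCyclotomicExtension {p} ℚ L := by
    change IsCyclotomicExtension {p} ℚ L.toSubalgebra
    rw [IntermediateField.adjoin_simple_toSubalgebra_of_isAlgebraic
      (hζ.isIntegral hp.pos).tower_top.isAlgebraic]
    exact hζ.adjoin_isCyclotomicExtension ℚ
  have : NumberField L := IsCyclotomicExtension.numberField {p} ℚ L
  let _ : Algebra K L := (IntermediateField.inclusion hKle).toAlgebra
  have hfin : Module.finrank K L = f := by
    have := Module.finrank_mul_finrank ℚ K L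
    rw [IsCyclotomicExtension.finrank (n := p) L (Polynomial.cyclotomic.irreducible_rat hp.pos),
      Nat.totient_prime hp, hdeg, hpef, Nat.add_sub_cancel] at this
    exact Nat.eq_of_mul_eq_mul_left he this
  have hsign : (-1 : ℤ) ^ NumberField.InfinitePlace.nrComplexPlaces K =
      if (e - 1) % 4 = 1 ∧ f % 2 = 1 then -1 else 1 := by
    rcases Nat.even_or_odd f with hf2 | hf2
    · have := isTotallyReal_of_algebra_cyclotomic (p := p) K L (hfin ▸ hf2)
      rw [NumberField.IsTotallyReal.nrComplexPlaces_eq_zero, if_neg (by grind), pow_zero]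
    · obtain rfl | hp2 := hp.eq_two_or_odd'
      · have := NumberField.InfinitePlace.card_add_two_mul_card_eq_rank K
        have he1 : e = 1 := by nlinarith
        have h0 : NumberField.InfinitePlace.nrComplexPlaces K = 0 := by omega
        simp [h0, he1]
      · have hlt : 2 < p := by have := hp.two_le; grind
        have := isTotallyComplex_of_algebra_cyclotomic hlt K L (hfin ▸ hf2)
        have h2 := NumberField.IsTotallyComplex.finrank K
        rw [hdeg] at h2
        rcases Nat.even_or_odd (NumberField.InfinitePlace.nrComplexPlaces K) with h | h
        · rw [h.neg_one_pow, if_neg (by grind)]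
        · rw [h.neg_one_pow, if_pos (by grind)]
  rw [← Int.sign_mul_natAbs (NumberField.discr K), NumberField.sign_discr,
    natAbs_discr_of_algebra_cyclotomic (p := p) K L, hdeg, hsign]
  split_ifs <;> simp
end

section
/- The polynomial f(X) = X^3 − X^2 − 2X − 8 is irreducible over ℚ; if K = ℚ(θ) is the cubic number field generated by a root θ of f, then K is not monogenic: there is no algebraic integer α ∈ 𝓞_K such that 𝓞_K = ℤ[α] (i.e., 𝓞_K admits no power integral basis). -/
open Polynomial

theorem dedekind_cubic_irreducible :
    Irreducible (X ^ 3 - X ^ 2 - 2 * X - 8 : Polynomial ℚ) := by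
  have hdeg : (X ^ 3 - X ^ 2 - 2 * X - 8 : Polynomial ℚ).natDegree = 3 := by compute_degree!
  refine (Polynomial.irreducible_iff_roots_eq_zero_of_degree_le_three (by omega) (by omega)).2 ?_
  refine Multiset.eq_zero_of_forall_notMem fun q hq => ?_
  have hroot : q ^ 3 - q ^ 2 - 2 * q - 8 = 0 := by simpa using (Polynomial.mem_roots'.1 hq).2
  have hint : IsIntegral ℤ q := by
    refine ⟨X ^ 3 - X ^ 2 - 2 * X - 8, by monicity!, ?_⟩
    simpa [← aeval_def] using hroot
  obtain ⟨n, rfl⟩ := IsIntegrallyClosed.isIntegral_iff.1 hint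
  have hn : n ^ 3 - n ^ 2 - 2 * n - 8 = 0 := by
    simp only [eq_intCast] at hroot
    exact_mod_cast hroot
  have hmod := congrArg (Int.cast : ℤ → ZMod 3) hn
  push_cast at hmod
  generalize (n : ZMod 3) = m at hmod
  revert m
  decide

/-- An embedding of the field generated by a root of Dedekind's cubic, sending that root to a
prescribed root. -/
theorem exists_algHom_of_dedekind_root {K L : Type*} [Field K] [NumberField K] [Field L]
    [Algebra ℚ L] {θ : K} (hθ : θ ^ 3 - θ ^ 2 - 2 * θ - 8 = 0)
    (hgen : IntermediateField.adjoin ℚ {θ} = ⊤) {z : L}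
    (hz : z ^ 3 - z ^ 2 - 2 * z - 8 = 0) : ∃ φ : K →ₐ[ℚ] L, φ θ = z := by
  have hmin : minpoly ℚ θ = X ^ 3 - X ^ 2 - 2 * X - 8 :=
    (minpoly.eq_of_irreducible_of_monic dedekind_cubic_irreducible (by simpa [map_ofNat] using hθ)
      (by monicity!)).symm
  have hint : IsIntegral ℚ θ := Algebra.IsIntegral.isIntegral θ
  have hmem : z ∈ (minpoly ℚ θ).aroots L :=
    mem_aroots.2 ⟨minpoly.ne_zero hint, by simpa [hmin, map_ofNat] using hz⟩
  let ψ := (IntermediateField.algHomAdjoinIntegralEquiv ℚ hint).symm ⟨z, hmem⟩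
  let e : K →ₐ[ℚ] IntermediateField.adjoin ℚ {θ} :=
    ((IntermediateField.equivOfEq hgen).trans IntermediateField.topEquiv).symm.toAlgHom
  refine ⟨ψ.comp e, ?_⟩
  have he : e θ = IntermediateField.AdjoinSimple.gen ℚ θ := Subtype.ext rfl
  refine (congrArg ψ he).trans ?_
  exact IntermediateField.algHomAdjoinIntegralEquiv_symm_apply_gen ℚ hint ⟨z, hmem⟩

theorem exists_padicInt_eq_of_isIntegral {p : ℕ} [Fact p.Prime] {x : ℚ_[p]}
    (hx : IsIntegral ℤ x) : ∃ c : ℤ_[p], (c : ℚ_[p]) = x :=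
  IsIntegrallyClosed.isIntegral_iff.1 (hx.tower_top (A := ℤ_[p]))

/-- Two embeddings into `ℚ_[p]` that agree modulo `p` at `α` agree modulo `p` on `ℤ[α]`. -/
theorem toZMod_eq_of_mem_adjoin {p : ℕ} [Fact p.Prime] {K : Type*} [Field K] [Algebra ℚ K]
    {φ ψ : K →ₐ[ℚ] ℚ_[p]} {α x : K} (hx : x ∈ Algebra.adjoin ℤ ({α} : Set K))
    {a b c d : ℤ_[p]} (ha : (a : ℚ_[p]) = φ α) (hb : (b : ℚ_[p]) = ψ α)
    (hab : PadicInt.toZMod a = PadicInt.toZMod b)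
    (hc : (c : ℚ_[p]) = φ x) (hd : (d : ℚ_[p]) = ψ x) :
    PadicInt.toZMod c = PadicInt.toZMod d := by
  rw [Algebra.adjoin_singleton_eq_range_aeval] at hx
  obtain ⟨P, rfl⟩ := hx
  have eval_eq (χ : K →ₐ[ℚ] ℚ_[p]) (u v : ℤ_[p]) (hu : (u : ℚ_[p]) = χ α)
      (hv : (v : ℚ_[p]) = χ (aeval α P)) : v = aeval u P := by
    apply PadicInt.ext
    have h₁ : χ (aeval α P) = aeval (χ α) P :=
      (aeval_algHom_apply (χ.restrictScalars ℤ) α P).symm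
    have h₂ : ((aeval u P : ℤ_[p]) : ℚ_[p]) = aeval (u : ℚ_[p]) P :=
      (aeval_algebraMap_apply ℚ_[p] u P).symm
    exact hv.trans (h₁.trans (by rw [h₂, hu]))
  have toZMod_aeval (u : ℤ_[p]) :
      PadicInt.toZMod (aeval u P) = aeval (PadicInt.toZMod u) P :=
    (aeval_algHom_apply (PadicInt.toZMod (p := p)).toIntAlgHom u P).symm
  rw [eval_eq φ a c ha hc, eval_eq ψ b d hb hd, toZMod_aeval, toZMod_aeval, hab]

/-- Hensel's lemma for a simple root modulo `p` of an integer polynomial. -/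
theorem exists_padicInt_root {p : ℕ} [Fact p.Prime] (F : ℤ[X]) (a : ℤ)
    (ha : (p : ℤ) ∣ F.eval a) (ha' : ¬ (p : ℤ) ∣ F.derivative.eval a) :
    ∃ t : ℤ_[p], aeval t F = 0 := by
  have aeval_cast (G : ℤ[X]) : aeval (a : ℤ_[p]) G = ((G.eval a : ℤ) : ℤ_[p]) := by
    simpa using aeval_algebraMap_apply ℤ_[p] a G
  have hlt : ‖((F.eval a : ℤ) : ℤ_[p])‖ < 1 := (PadicInt.norm_int_lt_one_iff_dvd _).2 ha
  have hone : ‖((F.derivative.eval a : ℤ) : ℤ_[p])‖ = 1 :=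
    le_antisymm (PadicInt.norm_le_one _)
      (not_lt.1 fun h => ha' ((PadicInt.norm_int_lt_one_iff_dvd _).1 h))
  obtain ⟨t, ht, -⟩ := hensels_lemma (F := F) (a := (a : ℤ_[p]))
    (by rw [aeval_cast, aeval_cast, hone]; simpa using hlt)
  exact ⟨t, ht⟩

/-- Dedekind's cubic has a root in each of the classes `1 + 2ℤ₂`, `2 + 4ℤ₂` and `4ℤ₂`. -/
theorem exists_dedekind_roots :
    (∃ t : ℤ_[2], (1 + 2 * t) ^ 3 - (1 + 2 * t) ^ 2 - 2 * (1 + 2 * t) - 8 = 0) ∧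
    (∃ t : ℤ_[2], (2 + 4 * t) ^ 3 - (2 + 4 * t) ^ 2 - 2 * (2 + 4 * t) - 8 = 0) ∧
    (∃ t : ℤ_[2], (4 * t) ^ 3 - (4 * t) ^ 2 - 2 * (4 * t) - 8 = 0) := by
  refine ⟨?_, ?_, ?_⟩
  · obtain ⟨t, ht⟩ := exists_padicInt_root (p := 2)
      (4 * X ^ 3 + 4 * X ^ 2 - X - 5) 1 (by norm_num) (by norm_num [derivative_ofNat])
    simp only [map_sub, map_add, map_mul, map_pow, aeval_X, map_ofNat] at ht
    exact ⟨t, by linear_combination 2 * ht⟩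
  · obtain ⟨t, ht⟩ := exists_padicInt_root (p := 2)
      (8 * X ^ 3 + 10 * X ^ 2 + 3 * X - 1) 1 (by norm_num) (by norm_num [derivative_ofNat])
    simp only [map_sub, map_add, map_mul, map_pow, aeval_X, map_ofNat, map_one] at ht
    exact ⟨t, by linear_combination 8 * ht⟩
  · obtain ⟨t, ht⟩ := exists_padicInt_root (p := 2)
      (8 * X ^ 3 - 2 * X ^ 2 - X - 1) 1 (by norm_num) (by norm_num [derivative_ofNat])
    simp only [map_sub, map_mul, map_pow, aeval_X, map_ofNat, map_one] at ht
    exact ⟨t, by linear_combination 8 * ht⟩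

/-- Dedekind's example: `f(X) = X^3 − X^2 − 2X − 8` is irreducible over `ℚ`, and the cubic
number field `K = ℚ(θ)` generated by a root `θ` of `f` is not monogenic: there is no
`α ∈ 𝓞_K` with `𝓞_K = ℤ[α]`. -/
theorem dedekind_field_not_monogenic (K : Type*) [Field K] [NumberField K]
    (θ : K) (hθ : θ ^ 3 - θ ^ 2 - 2 * θ - 8 = 0)
    (hgen : IntermediateField.adjoin ℚ {θ} = ⊤) :
    Irreducible (X ^ 3 - X ^ 2 - 2 * X - 8 : Polynomial ℚ) ∧
    ¬ ∃ α : K, Algebra.adjoin ℤ ({α} : Set K) = integralClosure ℤ K := by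
  refine ⟨dedekind_cubic_irreducible, ?_⟩
  rintro ⟨α, hα⟩
  have hαint : IsIntegral ℤ α :=
    (hα ▸ Algebra.self_mem_adjoin_singleton ℤ α : α ∈ integralClosure ℤ K)
  have hθint : IsIntegral ℤ θ :=
    ⟨X ^ 3 - X ^ 2 - 2 * X - 8, by monicity!, by simpa [← aeval_def, map_ofNat] using hθ⟩
  have hηint : IsIntegral ℤ ((θ ^ 2 + θ) / 2) := by
    refine ⟨X ^ 3 - 3 * X ^ 2 - 10 * X - 8, by monicity!, ?_⟩
    simp only [← aeval_def, map_sub, map_mul, map_pow, aeval_X, map_ofNat]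
    linear_combination ((θ ^ 3 + 4 * θ ^ 2 + 3 * θ + 8) / 8) * hθ
  have hθmem : θ ∈ Algebra.adjoin ℤ ({α} : Set K) := hα ▸ hθint
  have hηmem : (θ ^ 2 + θ) / 2 ∈ Algebra.adjoin ℤ ({α} : Set K) := hα ▸ hηint
  have key (z c : ℤ_[2]) (hz : z ^ 3 - z ^ 2 - 2 * z - 8 = 0) (hc : 2 * c = z ^ 2 + z) :
      ∃ (φ : K →ₐ[ℚ] ℚ_[2]) (a : ℤ_[2]), (a : ℚ_[2]) = φ α ∧ (z : ℚ_[2]) = φ θ ∧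
        (c : ℚ_[2]) = φ ((θ ^ 2 + θ) / 2) := by
    obtain ⟨φ, hφ⟩ := exists_algHom_of_dedekind_root (L := ℚ_[2]) hθ hgen (z := z)
      (by exact_mod_cast congrArg ((↑) : ℤ_[2] → ℚ_[2]) hz)
    obtain ⟨a, ha⟩ := exists_padicInt_eq_of_isIntegral (hαint.map (φ.restrictScalars ℤ))
    refine ⟨φ, a, ha, hφ.symm, ?_⟩
    have hc' : 2 * (c : ℚ_[2]) = z ^ 2 + z := by
      exact_mod_cast congrArg ((↑) : ℤ_[2] → ℚ_[2]) hc
    rw [map_div₀, map_add, map_pow, hφ, map_ofNat]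
    linear_combination hc' / 2
  have two_zero : (2 : ZMod 2) = 0 := rfl
  have four_zero : (4 : ZMod 2) = 0 := rfl
  obtain ⟨⟨r, hr⟩, ⟨s, hs⟩, ⟨t, ht⟩⟩ := exists_dedekind_roots
  obtain ⟨φ₁, a₁, h₁, hz₁, hc₁⟩ := key _ ((1 + 2 * r) * (1 + r)) hr (by ring)
  obtain ⟨φ₂, a₂, h₂, hz₂, hc₂⟩ := key _ ((1 + 2 * s) * (3 + 4 * s)) hs (by ring)
  obtain ⟨φ₃, a₃, h₃, hz₃, hc₃⟩ := key _ (2 * t * (4 * t + 1)) ht (by ring)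
  have h₁₂ : PadicInt.toZMod a₁ ≠ PadicInt.toZMod a₂ := fun h => by
    have := toZMod_eq_of_mem_adjoin hθmem h₁ h₂ h hz₁ hz₂
    simp [map_ofNat, two_zero, four_zero] at this
  have h₁₃ : PadicInt.toZMod a₁ ≠ PadicInt.toZMod a₃ := fun h => by
    have := toZMod_eq_of_mem_adjoin hθmem h₁ h₃ h hz₁ hz₃
    simp [map_ofNat, two_zero, four_zero] at this
  have h₂₃ : PadicInt.toZMod a₂ ≠ PadicInt.toZMod a₃ := fun h => by
    have := toZMod_eq_of_mem_adjoin hηmem h₂ h₃ h hc₂ hc₃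
    have three_one : (3 : ZMod 2) = 1 := rfl
    simp [map_ofNat, two_zero, four_zero, three_one] at this
  have pigeonhole : ∀ x y z : ZMod 2, x ≠ y → x ≠ z → y ≠ z → False := by decide
  exact pigeonhole _ _ _ h₁₂ h₁₃ h₂₃
end
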